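/- For every integer q ≥ 1 and every ℓ ∈ ℤⁿ, the coefficient of the monomial ξ_j^{q} in the polynomial Σ_{i=1}^{n} ℓ_i ω^{(1)}_i(ξ) equals −q(q+1) ℓ_j, for each j ∈ {1,…,n}. Consequently the ℤ-linear map ℤⁿ → ℝ[ξ₁,…,ξₙ] sending ℓ to Σ_{i=1}^{n} ℓ_i ω^{(1)}_i is injective. -/

import Mathlib

/-- The polynomial `A_r(ξ) = Σ_{|k| = r} (r!/(k₁!⋯kₙ!))² ξ^k`. -/
noncomputable def Apoly (n r : ℕ) : MvPolynomial (Fin n) ℝ :=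
  ∑ k ∈ (Fintype.piFinset fun _ : Fin n => Finset.range (r + 1)).filter
      (fun k => (∑ i, k i) = r),
    MvPolynomial.C ((Nat.multinomial Finset.univ k : ℝ) ^ 2) *
      ∏ i, MvPolynomial.X i ^ k i

/-- The frequency modulation `ω⁽¹⁾_i(ξ) = ∂_{ξ_i} A_{q+1}(ξ) − (q+1)² A_q(ξ)` of the q-NLS. -/
noncomputable def omega1 (n q : ℕ) (i : Fin n) : MvPolynomial (Fin n) ℝ :=
  MvPolynomial.pderiv i (Apoly n (q + 1)) -
    MvPolynomial.C (((q : ℝ) + 1) ^ 2) * Apoly n q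

open MvPolynomial in
/-- The coefficient of `ξ^m` in `A_r` is the squared multinomial coefficient when `|m| = r`. -/
theorem coeff_Apoly {n r : ℕ} (m : Fin n →₀ ℕ) (hm : ∑ i, m i = r) :
    coeff m (Apoly n r) = (Nat.multinomial Finset.univ m : ℝ) ^ 2 := by
  classical
  have key (k : Fin n → ℕ) :
      coeff m (C ((Nat.multinomial Finset.univ k : ℝ) ^ 2) *
        ∏ i, (X i : MvPolynomial (Fin n) ℝ) ^ k i) =
      if k = ⇑m then (Nat.multinomial Finset.univ k : ℝ) ^ 2 else 0 := by
    have h : ∏ i, (X i : MvPolynomial (Fin n) ℝ) ^ k i =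
        monomial (Finsupp.equivFunOnFinite.symm k) 1 := by
      rw [monomial_eq, Finsupp.prod_fintype _ _ (fun _ => pow_zero _)]
      simp
    rw [h, coeff_C_mul, coeff_monomial]
    simp only [Equiv.symm_apply_eq, mul_ite, mul_one, mul_zero]
    rfl
  rw [Apoly, coeff_sum, Finset.sum_congr rfl fun k _ => key k, Finset.sum_ite_eq', if_pos]
  simp only [Finset.mem_filter, Fintype.mem_piFinset, Finset.mem_range]
  exact ⟨fun i => Nat.lt_succ_of_le
    (hm ▸ Finset.single_le_sum (fun _ _ => Nat.zero_le _) (Finset.mem_univ i)), hm⟩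

theorem multinomial_univ_single {ι : Type*} [Fintype ι] (j : ι) (q : ℕ) :
    Nat.multinomial Finset.univ (Finsupp.single j q) = 1 := by
  classical
  have h := Nat.multinomial_spec Finset.univ (Finsupp.single j q)
  rw [Finset.prod_eq_single j (fun b _ hb => by simp [Finsupp.single_eq_of_ne hb]) (by simp),
    Finset.sum_eq_single j (fun b _ hb => by simp [Finsupp.single_eq_of_ne hb]) (by simp),
    Finsupp.single_eq_same] at h
  exact Nat.eq_of_mul_eq_mul_left q.factorial_pos (by rw [h, mul_one])

theorem multinomial_univ_single_add_single_one {ι : Type*} [Fintype ι] {i j : ι} (hij : i ≠ j)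
    (q : ℕ) :
    Nat.multinomial Finset.univ (Finsupp.single j q + Finsupp.single i 1 : ι →₀ ℕ) = q + 1 := by
  classical
  have h := Nat.multinomial_spec Finset.univ (Finsupp.single j q + Finsupp.single i 1 : ι →₀ ℕ)
  rw [Finset.prod_eq_single j (fun b _ hb => by
      by_cases hbi : b = i <;> simp [hb.symm, hbi, hij.symm, eq_comm])
      (by simp)] at h
  have hs : ∑ b, (Finsupp.single j q + Finsupp.single i 1 : ι →₀ ℕ) b = q + 1 := by
    simp [Finset.sum_add_distrib, Finsupp.single_apply]
  rw [hs, Nat.factorial_succ, Finsupp.add_apply, Finsupp.single_eq_same,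
    Finsupp.single_eq_of_ne hij.symm, add_zero, mul_comm (q + 1)] at h
  exact Nat.eq_of_mul_eq_mul_left q.factorial_pos h

open MvPolynomial in
/-- The coefficient of `ξ_j^q` in `ω⁽¹⁾_i`. -/
theorem coeff_single_omega1 {n : ℕ} (q : ℕ) (i j : Fin n) :
    coeff (Finsupp.single j q) (omega1 n q i) =
      if i = j then -((q : ℝ) * ((q : ℝ) + 1)) else 0 := by
  have hs : ∑ b, (Finsupp.single j q : Fin n →₀ ℕ) b = q := by
    simp [Finsupp.single_apply]
  have hs' : ∑ b, (Finsupp.single j q + Finsupp.single i 1 : Fin n →₀ ℕ) b = q + 1 := by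
    simp [Finset.sum_add_distrib, Finsupp.single_apply]
  rw [omega1, coeff_sub, coeff_C_mul, coeff_Apoly _ hs, multinomial_univ_single,
    coeff_pderiv, coeff_Apoly _ hs']
  split_ifs with h
  · subst h
    rw [← Finsupp.single_add, multinomial_univ_single]
    simp
    ring
  · rw [multinomial_univ_single_add_single_one h, Finsupp.single_eq_of_ne h]
    simp

/-- (Remark `connl` (1).) The coefficient of `ξ_j^q` in `Σ_i ℓ_i ω⁽¹⁾_i(ξ)`
is `−q(q+1) ℓ_j`; consequently `ℓ ↦ Σ_i ℓ_i ω⁽¹⁾_i` is injective on `ℤⁿ`. -/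
theorem omega1_combination_coeff_and_injective (n q : ℕ) (hn : 1 ≤ n) (hq : 1 ≤ q) :
    (∀ (ℓ : Fin n → ℤ) (j : Fin n),
      MvPolynomial.coeff (Finsupp.single j q)
          (∑ i, MvPolynomial.C ((ℓ i : ℝ)) * omega1 n q i)
        = -((q : ℝ) * ((q : ℝ) + 1)) * (ℓ j : ℝ)) ∧
    Function.Injective
      (fun ℓ : Fin n → ℤ => ∑ i, MvPolynomial.C ((ℓ i : ℝ)) * omega1 n q i) := by
  have hcoeff (ℓ : Fin n → ℤ) (j : Fin n) :
      MvPolynomial.coeff (Finsupp.single j q)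
          (∑ i, MvPolynomial.C ((ℓ i : ℝ)) * omega1 n q i)
        = -((q : ℝ) * ((q : ℝ) + 1)) * (ℓ j : ℝ) := by
    simp only [MvPolynomial.coeff_sum, MvPolynomial.coeff_C_mul, coeff_single_omega1, mul_ite,
      mul_zero, Finset.sum_ite_eq', Finset.mem_univ, if_true]
    ring
  refine ⟨hcoeff, fun ℓ ℓ' h => funext fun j => ?_⟩
  have hj := congrArg (MvPolynomial.coeff (Finsupp.single j q)) h
  simp only [hcoeff] at hj
  have hq0 : (0 : ℝ) < q := by exact_mod_cast hq
  exact_mod_cast mul_left_cancel₀ (neg_ne_zero.mpr (by positivity)) hj
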